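/- In the first-price auction with all bidders value maximizers (B_v = {1,…,n}, B_u = ∅), for every equilibrium strategy profile, twice the expected welfare is at least the optimal welfare: 2 · Σ_i E[val i] ≥ Σ_j max_i v i j. In particular, the instance-wise price of anarchy (Σ_i E[val i]) / (Σ_j max_i v i j) is at least 1/2 for every equilibrium of every instance. -/

import Mathlib

open MeasureTheory Finset
open scoped Classical

namespace FPA

variable {n m : ℕ}

/-- Bidder `i` wins auction `j` under bid profile `b`: highest bid, ties broken
in favor of larger value, then smaller index. -/
def Wins (v b : Fin n → Fin m → ℝ) (j : Fin m) (i : Fin n) : Prop :=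
  ∀ i', i' ≠ i →
    b i' j < b i j ∨ (b i' j = b i j ∧ (v i' j < v i j ∨ (v i' j = v i j ∧ i < i')))

/-- Indicator that bidder `i` wins auction `j`. -/
noncomputable def xind (v b : Fin n → Fin m → ℝ) (j : Fin m) (i : Fin n) : ℝ :=
  if Wins v b j i then 1 else 0

noncomputable def valij (v b : Fin n → Fin m → ℝ) (i : Fin n) (j : Fin m) : ℝ :=
  xind v b j i * v i j

noncomputable def payij (v b : Fin n → Fin m → ℝ) (i : Fin n) (j : Fin m) : ℝ :=
  xind v b j i * b i j

/-- Admissible strategy: probability distribution over nonnegative bid vectors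
with finite expectations. -/
def Admissible (σ : Measure (Fin m → ℝ)) : Prop :=
  IsProbabilityMeasure σ ∧ (∀ᵐ β ∂σ, ∀ j, 0 ≤ β j) ∧ ∀ j, Integrable (fun β => β j) σ

noncomputable def EValij (v : Fin n → Fin m → ℝ) (μ : Fin n → Measure (Fin m → ℝ))
    (i : Fin n) (j : Fin m) : ℝ :=
  ∫ b, valij v b i j ∂(Measure.pi μ)

noncomputable def EPayij (v : Fin n → Fin m → ℝ) (μ : Fin n → Measure (Fin m → ℝ))
    (i : Fin n) (j : Fin m) : ℝ :=
  ∫ b, payij v b i j ∂(Measure.pi μ)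

noncomputable def EVal (v : Fin n → Fin m → ℝ) (μ : Fin n → Measure (Fin m → ℝ))
    (i : Fin n) : ℝ :=
  ∑ j, EValij v μ i j

noncomputable def EPay (v : Fin n → Fin m → ℝ) (μ : Fin n → Measure (Fin m → ℝ))
    (i : Fin n) : ℝ :=
  ∑ j, EPayij v μ i j

noncomputable def EUtil (v : Fin n → Fin m → ℝ) (μ : Fin n → Measure (Fin m → ℝ))
    (i : Fin n) : ℝ :=
  EVal v μ i - EPay v μ i

/-- A utility maximizer best responds: no admissible deviation improves expected utility. -/
def UtilBest (v : Fin n → Fin m → ℝ) (μ : Fin n → Measure (Fin m → ℝ)) (i : Fin n) : Prop :=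
  ∀ σ, Admissible σ → EUtil v (Function.update μ i σ) i ≤ EUtil v μ i

/-- A value maximizer best responds: its ROI constraint holds and no admissible
deviation satisfying the ROI constraint yields more expected value. -/
def ValBest (v : Fin n → Fin m → ℝ) (μ : Fin n → Measure (Fin m → ℝ)) (i : Fin n) : Prop :=
  EPay v μ i ≤ EVal v μ i ∧
    ∀ σ, Admissible σ →
      EPay v (Function.update μ i σ) i ≤ EVal v (Function.update μ i σ) i →
      EVal v (Function.update μ i σ) i ≤ EVal v μ i

/-- Equilibrium: all strategies admissible, every utility maximizer in `Bu` and
every value maximizer in `Bv` best responds. -/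
def Equilibrium (v : Fin n → Fin m → ℝ) (Bu Bv : Finset (Fin n))
    (μ : Fin n → Measure (Fin m → ℝ)) : Prop :=
  (∀ i, Admissible (μ i)) ∧ (∀ i ∈ Bu, UtilBest v μ i) ∧ (∀ i ∈ Bv, ValBest v μ i)

/-- The rightful winner of auction `j`: the bidder with the highest value,
ties broken toward the smaller index. -/
noncomputable def rwinner [NeZero n] (v : Fin n → Fin m → ℝ) (j : Fin m) : Fin n :=
  (Finset.univ.filter fun i => ∀ i', v i' j ≤ v i j).min' (by
    obtain ⟨i, -, hi⟩ := Finset.exists_max_image (Finset.univ : Finset (Fin n))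
      (fun i => v i j) Finset.univ_nonempty
    exact ⟨i, Finset.mem_filter.mpr ⟨Finset.mem_univ _, fun i' => hi i' (Finset.mem_univ _)⟩⟩)

end FPA

open MeasureTheory Finset

namespace FPA

variable {n m : ℕ}

lemma exists_wins [NeZero n] (v b : Fin n → Fin m → ℝ) (j : Fin m) : ∃ i, Wins v b j i := by
  obtain ⟨i, -, hi⟩ := Finset.exists_max_image (Finset.univ : Finset (Fin n))
    (fun i => toLex (b i j, toLex (v i j, OrderDual.toDual i))) Finset.univ_nonempty
  refine ⟨i, fun i' hne => ?_⟩
  have h := hi i' (Finset.mem_univ _)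
  simp only [Prod.Lex.toLex_le_toLex, OrderDual.toDual_le_toDual] at h
  rcases h with h | ⟨h, h' | ⟨h', h''⟩⟩
  · exact Or.inl h
  · exact Or.inr ⟨h, Or.inl h'⟩
  · exact Or.inr ⟨h, Or.inr ⟨h', lt_of_le_of_ne h'' hne.symm⟩⟩

lemma le_rwinner [NeZero n] (v : Fin n → Fin m → ℝ) (j : Fin m) (i : Fin n) :
    v i j ≤ v (rwinner v j) j :=
  (Finset.mem_filter.mp (Finset.min'_mem
    (Finset.univ.filter fun i => ∀ i', v i' j ≤ v i j) _)).2 i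

lemma rwinner_le_of_eq [NeZero n] (v : Fin n → Fin m → ℝ) (j : Fin m) (i : Fin n)
    (h : v i j = v (rwinner v j) j) : rwinner v j ≤ i :=
  Finset.min'_le _ _ (Finset.mem_filter.mpr
    ⟨Finset.mem_univ _, fun i' => h ▸ le_rwinner v j i'⟩)

lemma sup'_eq_rwinner [NeZero n] (v : Fin n → Fin m → ℝ) (j : Fin m) :
    (Finset.univ.sup' Finset.univ_nonempty fun i => v i j) = v (rwinner v j) j :=
  le_antisymm (Finset.sup'_le _ _ fun i _ => le_rwinner v j i)
    (Finset.le_sup' (fun i => v i j) (Finset.mem_univ _))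

lemma measurable_xind (v : Fin n → Fin m → ℝ) (i : Fin n) (j : Fin m) :
    Measurable fun b => xind v b j i := by
  have hb : ∀ k : Fin n, Measurable fun b : Fin n → Fin m → ℝ => b k j := fun k =>
    (measurable_pi_apply j).comp (measurable_pi_apply k)
  refine Measurable.ite ?_ measurable_const measurable_const
  simp only [Wins, Set.ofPred_forall]
  refine MeasurableSet.iInter fun i' => MeasurableSet.iInter fun _ => ?_
  exact (measurableSet_lt (hb i') (hb i)).union
    ((measurableSet_eq_fun (hb i') (hb i)).inter (MeasurableSet.const _))

lemma xind_nonneg (v b : Fin n → Fin m → ℝ) (j : Fin m) (i : Fin n) : 0 ≤ xind v b j i := by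
  unfold xind; split_ifs <;> norm_num

lemma xind_le_one (v b : Fin n → Fin m → ℝ) (j : Fin m) (i : Fin n) : xind v b j i ≤ 1 := by
  unfold xind; split_ifs <;> norm_num

lemma measurable_valij (v : Fin n → Fin m → ℝ) (i : Fin n) (j : Fin m) :
    Measurable fun b => valij v b i j :=
  (measurable_xind v i j).mul_const _

lemma measurable_payij (v : Fin n → Fin m → ℝ) (i : Fin n) (j : Fin m) :
    Measurable fun b => payij v b i j :=
  (measurable_xind v i j).mul ((measurable_pi_apply j).comp (measurable_pi_apply i))

lemma integrable_valij (v : Fin n → Fin m → ℝ) (P : Measure (Fin n → Fin m → ℝ))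
    [IsProbabilityMeasure P] (i : Fin n) (j : Fin m) : Integrable (fun b => valij v b i j) P := by
  refine Integrable.of_bound (measurable_valij v i j).aestronglyMeasurable |v i j|
    (Filter.Eventually.of_forall fun b => ?_)
  rw [valij, Real.norm_eq_abs, abs_mul, abs_of_nonneg (xind_nonneg v b j i)]
  exact mul_le_of_le_one_left (abs_nonneg _) (xind_le_one v b j i)

lemma integrable_payij (v : Fin n → Fin m → ℝ) {P : Measure (Fin n → Fin m → ℝ)}
    (i : Fin n) (j : Fin m) (h : Integrable (fun b => b i j) P) :
    Integrable (fun b => payij v b i j) P := by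
  refine h.mono (measurable_payij v i j).aestronglyMeasurable
    (Filter.Eventually.of_forall fun b => ?_)
  rw [payij, norm_mul, Real.norm_eq_abs, abs_of_nonneg (xind_nonneg v b j i)]
  exact mul_le_of_le_one_left (norm_nonneg _) (xind_le_one v b j i)

/-- The deviation in which bidder `i` bids its value in the auctions it rightfully wins,
and `0` elsewhere. -/
noncomputable def truthful [NeZero n] (v : Fin n → Fin m → ℝ) (i : Fin n) (j : Fin m) : ℝ :=
  if rwinner v j = i then v i j else 0

lemma pi_update_dirac (μ : Fin n → Measure (Fin m → ℝ)) [∀ i, IsProbabilityMeasure (μ i)]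
    (i : Fin n) (β : Fin m → ℝ) :
    Measure.pi (Function.update μ i (Measure.dirac β)) =
      (Measure.pi μ).map fun b => Function.update b i β := by
  let f : Fin n → (Fin m → ℝ) → Fin m → ℝ := fun k x => if k = i then β else x
  have hf : ∀ k, Measurable (f k) := fun k => by
    by_cases hk : k = i
    · simp [f, hk]
    · simpa [f, hk] using measurable_id'
  have hmap : (fun k => (μ k).map (f k)) = Function.update μ i (Measure.dirac β) := by
    funext k
    by_cases hk : k = i
    · subst hk
      simp [f, Measure.map_const]
    · have : f k = id := by funext x; simp [f, hk]
      simp [this, hk]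
  have hfun : (fun (b : Fin n → Fin m → ℝ) k => f k (b k)) = fun b => Function.update b i β := by
    funext b k
    by_cases hk : k = i
    · subst hk
      simp [f]
    · simp [f, hk]
  have : ∀ k, SigmaFinite ((μ k).map (f k)) := fun k =>
    have := Measure.isProbabilityMeasure_map (μ := μ k) (hf k).aemeasurable
    inferInstance
  rw [← hmap, ← hfun, Measure.pi_map_pi fun k => (hf k).aemeasurable]

lemma payij_update_truthful_le [NeZero n] (v b : Fin n → Fin m → ℝ) (hv : ∀ i j, 0 ≤ v i j)
    (i : Fin n) (j : Fin m) :
    payij v (Function.update b i (truthful v i)) i j ≤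
      valij v (Function.update b i (truthful v i)) i j := by
  unfold payij valij
  refine mul_le_mul_of_nonneg_left ?_ (xind_nonneg _ _ _ _)
  rw [Function.update_self, truthful]
  split_ifs
  · exact le_rfl
  · exact hv i j

/-- Either the rightful winner wins by bidding its value, or the price already exceeds it. -/
lemma value_rwinner_le [NeZero n] (v b : Fin n → Fin m → ℝ) (hv : ∀ i j, 0 ≤ v i j)
    (hb : ∀ i j, 0 ≤ b i j) (j : Fin m) :
    v (rwinner v j) j ≤ ∑ i, payij v b i j +
      valij v (Function.update b (rwinner v j) (truthful v (rwinner v j))) (rwinner v j) j := by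
  set r := rwinner v j with hr
  have hpay : ∀ i, 0 ≤ payij v b i j := fun i => mul_nonneg (xind_nonneg _ _ _ _) (hb i j)
  by_cases h : ∃ k, v r j < b k j
  · obtain ⟨k, hk⟩ := h
    obtain ⟨w, hw⟩ := exists_wins v b j
    have hkw : b k j ≤ b w j := by
      by_cases hkw : k = w
      · rw [hkw]
      · rcases hw k hkw with h | h
        · exact h.le
        · exact h.1.le
    have h1 : payij v b w j ≤ ∑ i, payij v b i j :=
      Finset.single_le_sum (f := fun i => payij v b i j) (fun i _ => hpay i) (Finset.mem_univ w)
    have h2 : payij v b w j = b w j := by simp [payij, xind, hw]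
    have h3 : 0 ≤ valij v (Function.update b r (truthful v r)) r j :=
      mul_nonneg (xind_nonneg _ _ _ _) (hv _ _)
    linarith
  · push Not at h
    have hwin : Wins v (Function.update b r (truthful v r)) j r := by
      intro k hk
      have ht : truthful v r j = v r j := by rw [truthful, if_pos hr.symm]
      rw [Function.update_of_ne hk, Function.update_self, ht]
      rcases (h k).lt_or_eq with h | h
      · exact Or.inl h
      · refine Or.inr ⟨h, ?_⟩
        rcases (le_rwinner v j k).lt_or_eq with h' | h'
        · exact Or.inl h'
        · exact Or.inr ⟨h', lt_of_le_of_ne (rwinner_le_of_eq v j k h') hk.symm⟩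
    have h2 : valij v (Function.update b r (truthful v r)) r j = v r j := by
      simp [valij, xind, hwin]
    rw [h2]
    linarith [Finset.sum_nonneg fun i (_ : i ∈ Finset.univ) => hpay i]

lemma ValBest.deviation_le [NeZero n] {v : Fin n → Fin m → ℝ} (hv : ∀ i j, 0 ≤ v i j)
    {μ : Fin n → Measure (Fin m → ℝ)} [∀ i, IsProbabilityMeasure (μ i)] {i : Fin n}
    (h : ValBest v μ i) :
    ∑ j, ∫ b, valij v (Function.update b i (truthful v i)) i j ∂(Measure.pi μ) ≤ EVal v μ i := by
  have hupd : Measurable fun b : Fin n → Fin m → ℝ =>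
      Function.update b i (truthful v i) :=
    measurable_update_left
  have hprob : IsProbabilityMeasure
      ((Measure.pi μ).map fun b => Function.update b i (truthful v i)) :=
    Measure.isProbabilityMeasure_map hupd.aemeasurable
  have hval : EVal v (Function.update μ i (Measure.dirac (truthful v i))) i =
      ∑ j, ∫ b, valij v (Function.update b i (truthful v i)) i j ∂(Measure.pi μ) := by
    refine Finset.sum_congr rfl fun j _ => ?_
    rw [EValij, pi_update_dirac,
      integral_map hupd.aemeasurable (measurable_valij v i j).aestronglyMeasurable]
  rw [← hval]
  refine h.2 _ ⟨inferInstance, ?_, fun j => ?_⟩ (Finset.sum_le_sum fun j _ => ?_)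
  · rw [ae_dirac_eq]
    refine fun j => ?_
    unfold truthful
    split_ifs
    · exact hv i j
    · exact le_rfl
  · exact integrable_dirac enorm_lt_top
  · have hint := (integrable_valij v _ i j).comp_measurable
      (μ := Measure.pi μ) hupd
    rw [EPayij, EValij, pi_update_dirac,
      integral_map hupd.aemeasurable (measurable_valij v i j).aestronglyMeasurable,
      integral_map hupd.aemeasurable (measurable_payij v i j).aestronglyMeasurable]
    refine integral_mono_of_nonneg (Filter.Eventually.of_forall fun b => ?_) hint
      (Filter.Eventually.of_forall fun b => payij_update_truthful_le v b hv i j)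
    refine mul_nonneg (xind_nonneg _ _ _ _) ?_
    rw [Function.update_self, truthful]
    split_ifs
    · exact hv i j
    · exact le_rfl

lemma integral_value_rwinner_le [NeZero n] (v : Fin n → Fin m → ℝ) (hv : ∀ i j, 0 ≤ v i j)
    (μ : Fin n → Measure (Fin m → ℝ)) (hμ : ∀ i, Admissible (μ i)) (j : Fin m) :
    v (rwinner v j) j ≤ ∑ i, EPayij v μ i j +
      ∫ b, valij v (Function.update b (rwinner v j) (truthful v (rwinner v j))) (rwinner v j) j
        ∂(Measure.pi μ) := by
  have : ∀ i, IsProbabilityMeasure (μ i) := fun i => (hμ i).1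
  have hnonneg : ∀ᵐ b ∂(Measure.pi μ), ∀ i j, 0 ≤ b i j :=
    ae_all_iff.2 fun i =>
      (measurePreserving_eval μ i).quasiMeasurePreserving.ae (hμ i).2.1
  have hpay : ∀ i, Integrable (fun b => payij v b i j) (Measure.pi μ) := fun i =>
    integrable_payij v i j ((measurePreserving_eval μ i).integrable_comp_of_integrable
      ((hμ i).2.2 j))
  have hupd : Measurable fun b : Fin n → Fin m → ℝ =>
      Function.update b (rwinner v j) (truthful v (rwinner v j)) :=
    measurable_update_left
  have hprob := Measure.isProbabilityMeasure_map (μ := Measure.pi μ) hupd.aemeasurable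
  have hval : Integrable (fun b => valij v (Function.update b (rwinner v j)
      (truthful v (rwinner v j))) (rwinner v j) j) (Measure.pi μ) :=
    (integrable_valij v _ (rwinner v j) j).comp_measurable hupd
  have hsum := integrable_finsetSum Finset.univ fun i _ => hpay i
  calc v (rwinner v j) j = ∫ _, v (rwinner v j) j ∂(Measure.pi μ) := by simp
    _ ≤ ∫ b, (∑ i, payij v b i j + valij v (Function.update b (rwinner v j)
          (truthful v (rwinner v j))) (rwinner v j) j) ∂(Measure.pi μ) :=
        integral_mono_ae (integrable_const _) (hsum.add hval)
          (hnonneg.mono fun b hb => value_rwinner_le v b hv hb j)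
    _ = _ := by
        rw [integral_add hsum hval, integral_finsetSum _ fun i _ => hpay i]
        rfl

end FPA

/-- In the first-price auction with all bidders value maximizers,
for every equilibrium, twice the expected welfare is at least the optimal welfare;
in particular the instance-wise price of anarchy is at least `1/2`. -/
theorem fpa_full_autobidding_poa_half {n m : ℕ} [NeZero n]
    (v : Fin n → Fin m → ℝ) (hv : ∀ i j, 0 ≤ v i j)
    (μ : Fin n → Measure (Fin m → ℝ))
    (heq : FPA.Equilibrium v (∅ : Finset (Fin n)) (Finset.univ : Finset (Fin n)) μ)
    (hOPT : 0 < ∑ j, Finset.univ.sup' Finset.univ_nonempty fun i => v i j) :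
    (2 * ∑ i, FPA.EVal v μ i ≥
      ∑ j, Finset.univ.sup' Finset.univ_nonempty fun i => v i j) ∧
    (∑ i, FPA.EVal v μ i) /
        (∑ j, Finset.univ.sup' Finset.univ_nonempty fun i => v i j) ≥ 1 / 2 := by
  have hprob : ∀ i, IsProbabilityMeasure (μ i) := fun i => (heq.1 i).1
  have hbest : ∀ i, FPA.ValBest v μ i := fun i => heq.2.2 i (Finset.mem_univ i)
  have hmain : (∑ j, Finset.univ.sup' Finset.univ_nonempty fun i => v i j) ≤
      2 * ∑ i, FPA.EVal v μ i := by
    let D : Fin n → Fin m → ℝ := fun i j =>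
      ∫ b, FPA.valij v (Function.update b i (FPA.truthful v i)) i j ∂(Measure.pi μ)
    have hD : ∀ i j, 0 ≤ D i j := fun i j =>
      integral_nonneg fun b => mul_nonneg (FPA.xind_nonneg _ _ _ _) (hv i j)
    calc (∑ j, Finset.univ.sup' Finset.univ_nonempty fun i => v i j)
        = ∑ j, v (FPA.rwinner v j) j :=
          Finset.sum_congr rfl fun j _ => FPA.sup'_eq_rwinner v j
      _ ≤ ∑ j, (∑ i, FPA.EPayij v μ i j + ∑ i, D i j) :=
          Finset.sum_le_sum fun j _ =>
            (FPA.integral_value_rwinner_le v hv μ heq.1 j).trans <| add_le_add_right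
              (Finset.single_le_sum (f := fun i => D i j) (fun i _ => hD i j)
                (Finset.mem_univ (FPA.rwinner v j))) _
      _ = ∑ i, FPA.EPay v μ i + ∑ i, ∑ j, D i j := by
          rw [Finset.sum_add_distrib, Finset.sum_comm, Finset.sum_comm (f := fun j i => D i j)]
          rfl
      _ ≤ ∑ i, FPA.EVal v μ i + ∑ i, FPA.EVal v μ i :=
          add_le_add (Finset.sum_le_sum fun i _ => (hbest i).1)
            (Finset.sum_le_sum fun i _ => (hbest i).deviation_le hv)
      _ = 2 * ∑ i, FPA.EVal v μ i := by ring
  refine ⟨hmain, ?_⟩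
  rw [ge_iff_le, le_div_iff₀ hOPT]
  linarith
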